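/- Let r₁, r₂ be C¹ functions on an open set U ⊂ ℝ² satisfying the diagonal system (∂r₁/∂y) = −tan((3r₁ + r₂)/4)·(∂r₁/∂x) and (∂r₂/∂y) = −tan((r₁ + 3r₂)/4)·(∂r₂/∂x), where cos((3r₁ + r₂)/4) ≠ 0 and cos((r₁ + 3r₂)/4) ≠ 0 on U. Then the functions ψ = (r₁ + r₂)/2 and ρ = −sin²((r₁ − r₂)/4) satisfy the system (5.8) on U: (ρ sin ψ)_x + (ρ cos ψ)_y = 0 and ((ρ+1) sin ψ)_y − ((ρ+1) cos ψ)_x = 0. -/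

import Mathlib

open Real

/-- Partial derivative in the first variable of a function on `ℝ²`. -/
noncomputable def pdx (f : ℝ × ℝ → ℝ) (p : ℝ × ℝ) : ℝ := deriv (fun t => f (t, p.2)) p.1

/-- Partial derivative in the second variable of a function on `ℝ²`. -/
noncomputable def pdy (f : ℝ × ℝ → ℝ) (p : ℝ × ℝ) : ℝ := deriv (fun t => f (p.1, t)) p.2

/-- Chain rule for `ρ sin ψ` along a curve, written in Riemann invariants. -/
theorem hasDerivAt_rho_mul_sin {u v : ℝ → ℝ} {u' v' t : ℝ}
    (hu : HasDerivAt u u' t) (hv : HasDerivAt v v' t) :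
    HasDerivAt (fun s => -(sin ((u s - v s) / 4)) ^ 2 * sin ((u s + v s) / 2))
      (sin ((u t - v t) / 4) / 2 *
        (sin ((u t + 3 * v t) / 4) * v' - sin ((3 * u t + v t) / 4) * u')) t := by
  have ha := ((hu.sub hv).div_const 4).sin
  have hψ := ((hu.add hv).div_const 2).sin
  refine ((ha.pow 2).neg.mul hψ).congr_deriv ?_
  rw [show (u t + 3 * v t) / 4 = (u t + v t) / 2 - (u t - v t) / 4 by ring,
    show (3 * u t + v t) / 4 = (u t + v t) / 2 + (u t - v t) / 4 by ring, sin_sub, sin_add]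
  simp
  ring

/-- Chain rule for `ρ cos ψ` along a curve, written in Riemann invariants. -/
theorem hasDerivAt_rho_mul_cos {u v : ℝ → ℝ} {u' v' t : ℝ}
    (hu : HasDerivAt u u' t) (hv : HasDerivAt v v' t) :
    HasDerivAt (fun s => -(sin ((u s - v s) / 4)) ^ 2 * cos ((u s + v s) / 2))
      (sin ((u t - v t) / 4) / 2 *
        (cos ((u t + 3 * v t) / 4) * v' - cos ((3 * u t + v t) / 4) * u')) t := by
  have ha := ((hu.sub hv).div_const 4).sin
  have hψ := ((hu.add hv).div_const 2).cos
  refine ((ha.pow 2).neg.mul hψ).congr_deriv ?_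
  rw [show (u t + 3 * v t) / 4 = (u t + v t) / 2 - (u t - v t) / 4 by ring,
    show (3 * u t + v t) / 4 = (u t + v t) / 2 + (u t - v t) / 4 by ring, cos_sub, cos_add]
  simp
  ring

/-- Chain rule for `(ρ + 1) sin ψ` along a curve, written in Riemann invariants. -/
theorem hasDerivAt_rho_add_one_mul_sin {u v : ℝ → ℝ} {u' v' t : ℝ}
    (hu : HasDerivAt u u' t) (hv : HasDerivAt v v' t) :
    HasDerivAt (fun s => (-(sin ((u s - v s) / 4)) ^ 2 + 1) * sin ((u s + v s) / 2))
      (cos ((u t - v t) / 4) / 2 *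
        (cos ((3 * u t + v t) / 4) * u' + cos ((u t + 3 * v t) / 4) * v')) t := by
  have hψ := ((hu.add hv).div_const 2).sin
  have ha := ((hu.sub hv).div_const 4).sin
  refine (((ha.pow 2).neg.add_const 1).mul hψ).congr_deriv ?_
  rw [show (u t + 3 * v t) / 4 = (u t + v t) / 2 - (u t - v t) / 4 by ring,
    show (3 * u t + v t) / 4 = (u t + v t) / 2 + (u t - v t) / 4 by ring, cos_sub, cos_add]
  simp
  linear_combination cos ((u t + v t) / 2) * (-(u' + v')) / 2 *
    sin_sq_add_cos_sq ((u t - v t) / 4)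

/-- Chain rule for `(ρ + 1) cos ψ` along a curve, written in Riemann invariants. -/
theorem hasDerivAt_rho_add_one_mul_cos {u v : ℝ → ℝ} {u' v' t : ℝ}
    (hu : HasDerivAt u u' t) (hv : HasDerivAt v v' t) :
    HasDerivAt (fun s => (-(sin ((u s - v s) / 4)) ^ 2 + 1) * cos ((u s + v s) / 2))
      (-(cos ((u t - v t) / 4) / 2 *
        (sin ((3 * u t + v t) / 4) * u' + sin ((u t + 3 * v t) / 4) * v'))) t := by
  have hψ := ((hu.add hv).div_const 2).cos
  have ha := ((hu.sub hv).div_const 4).sin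
  refine (((ha.pow 2).neg.add_const 1).mul hψ).congr_deriv ?_
  rw [show (u t + 3 * v t) / 4 = (u t + v t) / 2 - (u t - v t) / 4 by ring,
    show (3 * u t + v t) / 4 = (u t + v t) / 2 + (u t - v t) / 4 by ring, sin_sub, sin_add]
  simp
  linear_combination -sin ((u t + v t) / 2) * (-(u' + v')) / 2 *
    sin_sq_add_cos_sq ((u t - v t) / 4)

theorem hasDerivAt_pdx {f : ℝ × ℝ → ℝ} {p : ℝ × ℝ} (hf : DifferentiableAt ℝ f p) :
    HasDerivAt (fun t => f (t, p.2)) (pdx f p) p.1 :=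
  (DifferentiableAt.comp (f := fun t : ℝ => (t, p.2)) p.1 hf (by fun_prop)).hasDerivAt

theorem hasDerivAt_pdy {f : ℝ × ℝ → ℝ} {p : ℝ × ℝ} (hf : DifferentiableAt ℝ f p) :
    HasDerivAt (fun t => f (p.1, t)) (pdy f p) p.2 :=
  (DifferentiableAt.comp (f := fun t : ℝ => (p.1, t)) p.2 hf (by fun_prop)).hasDerivAt

/-- If the Riemann invariants `r₁, r₂` satisfy the diagonal system
`(r₁)_y = −tan((3r₁+r₂)/4)(r₁)_x`, `(r₂)_y = −tan((r₁+3r₂)/4)(r₂)_x`, then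
`ψ = (r₁+r₂)/2` and `ρ = −sin²((r₁−r₂)/4)` solve the system (5.8). -/
theorem statement9 (U : Set (ℝ × ℝ)) (hU : IsOpen U)
    (r₁ r₂ : ℝ × ℝ → ℝ)
    (hr₁ : ContDiffOn ℝ 1 r₁ U) (hr₂ : ContDiffOn ℝ 1 r₂ U)
    (hcos1 : ∀ p ∈ U, Real.cos ((3 * r₁ p + r₂ p) / 4) ≠ 0)
    (hcos2 : ∀ p ∈ U, Real.cos ((r₁ p + 3 * r₂ p) / 4) ≠ 0)
    (hsys1 : ∀ p ∈ U, pdy r₁ p = -Real.tan ((3 * r₁ p + r₂ p) / 4) * pdx r₁ p)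
    (hsys2 : ∀ p ∈ U, pdy r₂ p = -Real.tan ((r₁ p + 3 * r₂ p) / 4) * pdx r₂ p)
    (ψ ρ : ℝ × ℝ → ℝ)
    (hψdef : ψ = fun p => (r₁ p + r₂ p) / 2)
    (hρdef : ρ = fun p => -(Real.sin ((r₁ p - r₂ p) / 4)) ^ 2) :
    ∀ p ∈ U,
      pdx (fun q => ρ q * Real.sin (ψ q)) p + pdy (fun q => ρ q * Real.cos (ψ q)) p = 0 ∧
      pdy (fun q => (ρ q + 1) * Real.sin (ψ q)) p
        - pdx (fun q => (ρ q + 1) * Real.cos (ψ q)) p = 0 := by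
  subst hψdef hρdef
  intro p hp
  have hd₁ := (hr₁.differentiableOn one_ne_zero).differentiableAt (hU.mem_nhds hp)
  have hd₂ := (hr₂.differentiableOn one_ne_zero).differentiableAt (hU.mem_nhds hp)
  have h₁ : cos ((3 * r₁ p + r₂ p) / 4) * pdy r₁ p
      = -(sin ((3 * r₁ p + r₂ p) / 4) * pdx r₁ p) := by
    rw [hsys1 p hp, ← tan_mul_cos (hcos1 p hp)]
    ring
  have h₂ : cos ((r₁ p + 3 * r₂ p) / 4) * pdy r₂ p
      = -(sin ((r₁ p + 3 * r₂ p) / 4) * pdx r₂ p) := by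
    rw [hsys2 p hp, ← tan_mul_cos (hcos2 p hp)]
    ring
  have hx₁ := hasDerivAt_pdx hd₁
  have hx₂ := hasDerivAt_pdx hd₂
  have hy₁ := hasDerivAt_pdy hd₁
  have hy₂ := hasDerivAt_pdy hd₂
  constructor
  · have e₁ := (hasDerivAt_rho_mul_sin hx₁ hx₂).deriv
    have e₂ := (hasDerivAt_rho_mul_cos hy₁ hy₂).deriv
    rw [pdx, pdy, e₁, e₂]
    linear_combination sin ((r₁ p - r₂ p) / 4) / 2 * (h₂ - h₁)
  · have e₁ := (hasDerivAt_rho_add_one_mul_sin hy₁ hy₂).deriv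
    have e₂ := (hasDerivAt_rho_add_one_mul_cos hx₁ hx₂).deriv
    rw [pdx, pdy, e₁, e₂]
    linear_combination cos ((r₁ p - r₂ p) / 4) / 2 * (h₁ + h₂)
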